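/- The Haezendonck–Goovaerts premium principle satisfies the following strengthened Fatou property: for every sequence (X_n) ⊂ L^Φ with inf_{n∈ℕ} E[X_n] > −∞ and every X ∈ L^Φ, if X_n → X almost surely then π_α(X) ≤ liminf_n π_α(X_n). -/

import Mathlib

open MeasureTheory Filter Set Topology

/-- The Luxemburg norm associated with the Orlicz function `Θ`. -/
noncomputable def luxNorm {Ω : Type*} [MeasurableSpace Ω] (μ : Measure Ω)
    (Θ : ℝ → ℝ) (X : Ω → ℝ) : ℝ :=
  sInf {l : ℝ | 0 < l ∧ ∫⁻ ω, ENNReal.ofReal (Θ (|X ω| / l)) ∂μ ≤ 1}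

/-- Membership in the Orlicz space `L^Θ`. -/
def MemOrlicz {Ω : Type*} [MeasurableSpace Ω] (μ : Measure Ω)
    (Θ : ℝ → ℝ) (X : Ω → ℝ) : Prop :=
  Measurable X ∧ ∃ l : ℝ, 0 < l ∧ ∫⁻ ω, ENNReal.ofReal (Θ (|X ω| / l)) ∂μ < ⊤

/-- The Haezendonck–Goovaerts premium principle at level `α`. -/
noncomputable def piHG {Ω : Type*} [MeasurableSpace Ω] (μ : Measure Ω)
    (Φ : ℝ → ℝ) (α : ℝ) (X : Ω → ℝ) : ℝ :=
  ⨅ m : ℝ, (m + luxNorm μ (fun x => Φ x / (1 - α)) (fun ω => max (X ω - m) 0))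

theorem hg_support (Φ : ℝ → ℝ) (hΦ0 : Φ 0 = 0) (hΦ1 : Φ 1 = 1)
    (hΦconv : ConvexOn ℝ (Ici 0) Φ) :
    ∃ p : ℝ, 1 ≤ p ∧ ∀ x : ℝ, 0 ≤ x → 1 + p * (x - 1) ≤ Φ x := by
  have key : ∀ x : ℝ, 0 ≤ x → x < 1 → ∀ y : ℝ, 1 < y →
      (1 - Φ x) / (1 - x) ≤ (Φ y - 1) / (y - 1) := by
    intro x hx hx1 y hy
    have := hΦconv.slope_mono_adjacent (x := x) (y := 1) (z := y) hx
      (by simp only [mem_Ici]; linarith) hx1 hy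
    rwa [hΦ1] at this
  set S : Set ℝ := (fun x => (1 - Φ x) / (1 - x)) '' Ico 0 1 with hS
  have hne : S.Nonempty := ⟨_, 0, by simp, rfl⟩
  have hb : BddAbove S := by
    refine ⟨(Φ 2 - 1) / (2 - 1), ?_⟩
    rintro _ ⟨x, hx, rfl⟩
    exact key x hx.1 hx.2 2 (by norm_num)
  refine ⟨sSup S, ?_, ?_⟩
  · apply le_csSup hb
    exact ⟨0, by simp, by simp [hΦ0]⟩
  · intro x hx
    rcases lt_trichotomy x 1 with h | h | h
    · have := le_csSup hb ⟨x, ⟨hx, h⟩, rfl⟩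
      simp only at this
      rw [div_le_iff₀ (by linarith)] at this
      linarith
    · subst h; simp [hΦ1]
    · have : sSup S ≤ (Φ x - 1) / (x - 1) := by
        apply csSup_le hne
        rintro _ ⟨z, hz, rfl⟩
        exact key z hz.1 hz.2 x h
      rw [le_div_iff₀ (by linarith)] at this
      linarith

theorem hg_mono (Φ : ℝ → ℝ) (hΦmono : MonotoneOn Φ (Ici 0)) :
    Monotone (fun x => Φ (max x 0)) := fun x y h =>
  hΦmono (by simp) (by simp) (max_le_max h le_rfl)

theorem hg_scale (Φ : ℝ → ℝ) (hΦ0 : Φ 0 = 0) (hΦconv : ConvexOn ℝ (Ici 0) Φ)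
    (t x : ℝ) (ht : 0 ≤ t) (ht1 : t ≤ 1) (hx : 0 ≤ x) : Φ (t * x) ≤ t * Φ x := by
  have := hΦconv.2 (x := x) hx (y := 0) (by simp) ht (sub_nonneg.2 ht1) (by ring)
  simpa [hΦ0] using this

theorem hg_cont (Φ : ℝ → ℝ) (hΦ0 : Φ 0 = 0) (hΦ1 : Φ 1 = 1)
    (hΦmono : MonotoneOn Φ (Ici 0)) (hΦconv : ConvexOn ℝ (Ici 0) Φ) :
    Continuous (fun x => Φ (max x 0)) := by
  rw [continuous_iff_continuousAt]
  intro x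
  rcases lt_or_ge 0 x with h | h
  · have h1 : ContinuousOn Φ (interior (Ici 0)) := hΦconv.continuousOn_interior
    rw [interior_Ici] at h1
    have h2 : ContinuousAt Φ x := h1.continuousAt (Ioi_mem_nhds h)
    apply h2.congr
    filter_upwards [Ioi_mem_nhds h] with y hy
    rw [max_eq_left (le_of_lt hy)]
  · have e : Φ (max x 0) = 0 := by rw [max_eq_right h, hΦ0]
    change Tendsto (fun x => Φ (max x 0)) (𝓝 x) (𝓝 (Φ (max x 0)))
    rw [e]
    have t : Tendsto (fun y : ℝ => max y 0) (𝓝 x) (𝓝 0) := by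
      have : Continuous (fun y : ℝ => max y 0) := by fun_prop
      have := this.tendsto x
      rwa [max_eq_right h] at this
    refine tendsto_of_tendsto_of_tendsto_of_le_of_le' tendsto_const_nhds t ?_ ?_
    · filter_upwards with y
      have h0 : Φ 0 ≤ Φ (max y 0) := hΦmono (by simp) (by simp) (by simp)
      rwa [hΦ0] at h0
    · have : Iio (1 : ℝ) ∈ 𝓝 x := Iio_mem_nhds (by linarith)
      filter_upwards [this] with y hy
      have := hg_scale Φ hΦ0 hΦconv (max y 0) 1 (by simp)
        (max_le (le_of_lt hy) (by norm_num)) (by norm_num)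
      simpa [hΦ1] using this

theorem hg_meas {Ω : Type*} [MeasurableSpace Ω] (Φ : ℝ → ℝ) (hΦmono : MonotoneOn Φ (Ici 0))
    (Y : Ω → ℝ) (hY : Measurable Y) (l : ℝ) (hl : 0 < l) :
    Measurable (fun ω => Φ (|Y ω| / l)) := by
  have h := (hg_mono Φ hΦmono).measurable.comp ((hY.abs).div_const l)
  convert h using 2 with ω
  simp only [Function.comp]
  rw [max_eq_left (by positivity)]

theorem hg_nonneg (Φ : ℝ → ℝ) (hΦ0 : Φ 0 = 0) (hΦmono : MonotoneOn Φ (Ici 0))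
    (x : ℝ) (hx : 0 ≤ x) : 0 ≤ Φ x := by
  rw [← hΦ0]; exact hΦmono (by simp) hx hx

/-- Elements of the Orlicz space are integrable. -/
theorem hg_integrable {Ω : Type*} [MeasurableSpace Ω] (μ : Measure Ω) [IsProbabilityMeasure μ]
    (Φ : ℝ → ℝ) (hΦ0 : Φ 0 = 0) (hΦ1 : Φ 1 = 1)
    (hΦmono : MonotoneOn Φ (Ici 0)) (hΦconv : ConvexOn ℝ (Ici 0) Φ)
    (Y : Ω → ℝ) (hY : MemOrlicz μ Φ Y) : Integrable Y μ := by
  obtain ⟨hm, l, hl, hfin⟩ := hY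
  obtain ⟨p, hp, hs⟩ := hg_support Φ hΦ0 hΦ1 hΦconv
  have hI : Integrable (fun ω => Φ (|Y ω| / l)) μ := by
    refine ⟨(hg_meas Φ hΦmono Y hm l hl).aestronglyMeasurable, ?_⟩
    rw [hasFiniteIntegral_iff_ofReal]
    · exact hfin
    · filter_upwards with ω
      exact hg_nonneg Φ hΦ0 hΦmono _ (by positivity)
  have hI2 : Integrable (fun ω => l * (Φ (|Y ω| / l) + 1)) μ :=
    (hI.add (integrable_const 1)).const_mul l
  refine hI2.mono' hm.aestronglyMeasurable ?_
  filter_upwards with ω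
  have h0 : 0 ≤ |Y ω| / l := by positivity
  have h1 := hs _ h0
  have h2 := hg_nonneg Φ hΦ0 hΦmono _ h0
  have h3 : |Y ω| / l ≤ Φ (|Y ω| / l) + 1 := by
    by_contra hc
    push Not at hc
    nlinarith
  rw [div_le_iff₀ hl] at h3
  rw [Real.norm_eq_abs]; linarith

theorem hg_bound {Ω : Type*} [MeasurableSpace Ω] (μ : Measure Ω) [IsProbabilityMeasure μ]
    (Φ : ℝ → ℝ) (hΦ0 : Φ 0 = 0) (hΦmono : MonotoneOn Φ (Ici 0))
    (α : ℝ) (hα : α ∈ Ioo (0 : ℝ) 1) (p : ℝ) (hp : 1 ≤ p)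
    (hs : ∀ x : ℝ, 0 ≤ x → 1 + p * (x - 1) ≤ Φ x)
    (Y : Ω → ℝ) (hm : Measurable Y) (hYi : Integrable Y μ) (l : ℝ) (hl : 0 < l)
    (h : ∫⁻ ω, ENNReal.ofReal (Φ (|Y ω| / l) / (1 - α)) ∂μ ≤ 1) :
    ∫ ω, |Y ω| ∂μ ≤ (1 - α / p) * l := by
  have hα' : 0 < 1 - α := by linarith [hα.2]
  have hnn : ∀ ω, 0 ≤ Φ (|Y ω| / l) / (1 - α) := fun ω =>
    div_nonneg (hg_nonneg Φ hΦ0 hΦmono _ (by positivity)) hα'.le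
  have hms : AEStronglyMeasurable (fun ω => Φ (|Y ω| / l) / (1 - α)) μ :=
    ((hg_meas Φ hΦmono Y hm l hl).div_const _).aestronglyMeasurable
  have hI : Integrable (fun ω => Φ (|Y ω| / l) / (1 - α)) μ := by
    refine ⟨hms, ?_⟩
    rw [hasFiniteIntegral_iff_ofReal (by filter_upwards with ω using hnn ω)]
    exact lt_of_le_of_lt h (by simp)
  have hle : ∫ ω, Φ (|Y ω| / l) / (1 - α) ∂μ ≤ 1 := by
    rw [integral_eq_lintegral_of_nonneg_ae (by filter_upwards with ω using hnn ω) hms]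
    exact ENNReal.toReal_le_of_le_ofReal (by norm_num) (by simpa using h)
  have hab : Integrable (fun ω => |Y ω|) μ := hYi.abs
  have hJ : Integrable (fun ω => (1 + p * (|Y ω| / l - 1)) / (1 - α)) μ := by
    have h1 := (((hab.div_const l).sub (integrable_const 1)).const_mul p)
    exact ((integrable_const 1).add h1).div_const _
  have hcmp : ∫ ω, (1 + p * (|Y ω| / l - 1)) / (1 - α) ∂μ
      ≤ ∫ ω, Φ (|Y ω| / l) / (1 - α) ∂μ := by
    apply integral_mono hJ hI
    intro ω
    exact div_le_div_of_nonneg_right (hs _ (by positivity)) hα'.le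
  have hcalc : ∫ ω, (1 + p * (|Y ω| / l - 1)) / (1 - α) ∂μ
      = (1 + p * ((∫ ω, |Y ω| ∂μ) / l - 1)) / (1 - α) := by
    have h1 : Integrable (fun ω => |Y ω| / l - 1) μ := (hab.div_const l).sub (integrable_const 1)
    rw [integral_div, integral_add (integrable_const 1) (h1.const_mul p), integral_const_mul,
      integral_sub (hab.div_const l) (integrable_const 1), integral_div]
    simp
  rw [hcalc] at hcmp
  have h4 := hcmp.trans hle
  rw [div_le_one hα'] at h4
  have h5 : (∫ ω, |Y ω| ∂μ) / l ≤ 1 - α / p := by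
    have hp0 : 0 < p := by linarith
    have : α / p ≤ 1 - (∫ ω, |Y ω| ∂μ) / l := by
      rw [div_le_iff₀ hp0]; linarith
    linarith
  rwa [div_le_iff₀ hl] at h5

theorem hg_nonempty {Ω : Type*} [MeasurableSpace Ω] (μ : Measure Ω) [IsProbabilityMeasure μ]
    (Φ : ℝ → ℝ) (hΦ0 : Φ 0 = 0)
    (hΦmono : MonotoneOn Φ (Ici 0)) (hΦconv : ConvexOn ℝ (Ici 0) Φ)
    (α : ℝ) (hα : α ∈ Ioo (0 : ℝ) 1)
    (X : Ω → ℝ) (hX : MemOrlicz μ Φ X) (m : ℝ) :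
    {l : ℝ | 0 < l ∧ ∫⁻ ω, ENNReal.ofReal
      ((fun x => Φ x / (1 - α)) (|max (X ω - m) 0| / l)) ∂μ ≤ 1}.Nonempty := by
  obtain ⟨hm, l, hl, hfin⟩ := hX
  have hα' : 0 < 1 - α := by linarith [hα.2]
  have hI : Integrable (fun ω => Φ (|X ω| / l)) μ := by
    refine ⟨(hg_meas Φ hΦmono X hm l hl).aestronglyMeasurable, ?_⟩
    rw [hasFiniteIntegral_iff_ofReal]
    · exact hfin
    · filter_upwards with ω
      exact hg_nonneg Φ hΦ0 hΦmono _ (by positivity)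
  set K := ∫ ω, (Φ (|X ω| / l) + Φ (|m| / l)) ∂μ with hK
  have hI2 : Integrable (fun ω => Φ (|X ω| / l) + Φ (|m| / l)) μ := hI.add (integrable_const _)
  have hnn : ∀ ω, 0 ≤ Φ (|X ω| / l) + Φ (|m| / l) := fun ω =>
    add_nonneg (hg_nonneg Φ hΦ0 hΦmono _ (by positivity))
      (hg_nonneg Φ hΦ0 hΦmono _ (by positivity))
  have hK0 : 0 ≤ K := integral_nonneg hnn
  set s : ℝ := K / (1 - α) + 1 with hs
  have hs1 : 1 ≤ s := by
    have : 0 ≤ K / (1 - α) := by positivity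
    linarith
  have hs0 : 0 < s := by linarith
  refine ⟨s * (2 * l), by positivity, ?_⟩
  have hpt : ∀ ω, Φ (|max (X ω - m) 0| / (s * (2 * l))) / (1 - α)
      ≤ (Φ (|X ω| / l) + Φ (|m| / l)) * (1 / (s * (1 - α))) := by
    intro ω
    have h1 : |max (X ω - m) 0| ≤ |X ω| + |m| := by
      rw [abs_of_nonneg (le_max_right _ _)]
      apply max_le
      · linarith [le_abs_self (X ω), neg_abs_le m]
      · positivity
    have h2 : Φ (|max (X ω - m) 0| / (s * (2 * l)))
        ≤ Φ ((1 / s) * ((1 / 2) * (|X ω| / l) + (1 / 2) * (|m| / l))) := by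
      apply hΦmono
      · simp only [mem_Ici]; positivity
      · simp only [mem_Ici]; positivity
      · have : (1 / s) * ((1 / 2) * (|X ω| / l) + (1 / 2) * (|m| / l))
            = (|X ω| + |m|) / (s * (2 * l)) := by field_simp
        rw [this]
        exact div_le_div_of_nonneg_right h1 (by positivity)
    have h3 := hg_scale Φ hΦ0 hΦconv (1 / s)
      ((1 / 2) * (|X ω| / l) + (1 / 2) * (|m| / l)) (by positivity)
      (by rw [div_le_one hs0]; exact hs1) (by positivity)
    have h4 : Φ ((1 / 2) * (|X ω| / l) + (1 / 2) * (|m| / l))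
        ≤ (1 / 2) * Φ (|X ω| / l) + (1 / 2) * Φ (|m| / l) := by
      have hx1 : |X ω| / l ∈ Ici (0 : ℝ) := by simp only [mem_Ici]; positivity
      have hx2 : |m| / l ∈ Ici (0 : ℝ) := by simp only [mem_Ici]; positivity
      have := hΦconv.2 hx1 hx2 (show (0 : ℝ) ≤ 1 / 2 by norm_num)
        (show (0 : ℝ) ≤ 1 / 2 by norm_num) (by norm_num)
      simpa only [smul_eq_mul] using this
    have h5 : Φ (|max (X ω - m) 0| / (s * (2 * l))) ≤
        (1 / s) * (Φ (|X ω| / l) + Φ (|m| / l)) := by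
      refine h2.trans (h3.trans ?_)
      apply mul_le_mul_of_nonneg_left _ (by positivity)
      have := hnn ω
      linarith
    calc _ ≤ ((1 / s) * (Φ (|X ω| / l) + Φ (|m| / l))) / (1 - α) :=
          div_le_div_of_nonneg_right h5 hα'.le
      _ = _ := by field_simp
  calc ∫⁻ ω, ENNReal.ofReal (Φ (|max (X ω - m) 0| / (s * (2 * l))) / (1 - α)) ∂μ
      ≤ ∫⁻ ω, ENNReal.ofReal ((Φ (|X ω| / l) + Φ (|m| / l)) * (1 / (s * (1 - α)))) ∂μ :=
        lintegral_mono fun ω => ENNReal.ofReal_le_ofReal (hpt ω)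
    _ = ENNReal.ofReal (∫ ω, (Φ (|X ω| / l) + Φ (|m| / l)) * (1 / (s * (1 - α))) ∂μ) := by
        rw [ofReal_integral_eq_lintegral_ofReal (hI2.mul_const _)]
        filter_upwards with ω
        exact mul_nonneg (hnn ω) (by positivity)
    _ ≤ 1 := by
        rw [integral_mul_const, ← hK]
        rw [← ENNReal.ofReal_one]
        apply ENNReal.ofReal_le_ofReal
        rw [mul_one_div, div_le_one (by positivity)]
        have : s * (1 - α) = K + (1 - α) := by rw [hs]; field_simp
        linarith

theorem hg_lower {Ω : Type*} [MeasurableSpace Ω] (μ : Measure Ω) [IsProbabilityMeasure μ]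
    (Φ : ℝ → ℝ) (hΦ0 : Φ 0 = 0) (hΦ1 : Φ 1 = 1)
    (hΦmono : MonotoneOn Φ (Ici 0)) (hΦconv : ConvexOn ℝ (Ici 0) Φ)
    (α : ℝ) (hα : α ∈ Ioo (0 : ℝ) 1) :
    ∃ c : ℝ, 0 < c ∧ c < 1 ∧ ∀ X : Ω → ℝ, MemOrlicz μ Φ X → ∀ m : ℝ,
      ∫ ω, X ω ∂μ - m ≤
        c * luxNorm μ (fun x => Φ x / (1 - α)) (fun ω => max (X ω - m) 0) := by
  obtain ⟨p, hp, hs⟩ := hg_support Φ hΦ0 hΦ1 hΦconv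
  have hp0 : 0 < p := by linarith
  have hc0 : 0 < 1 - α / p := by
    have : α / p < 1 := by rw [div_lt_one hp0]; linarith [hα.2]
    linarith
  refine ⟨1 - α / p, hc0, ?_, ?_⟩
  · have : 0 < α / p := div_pos hα.1 hp0
    linarith
  · intro X hX m
    have hXi := hg_integrable μ Φ hΦ0 hΦ1 hΦmono hΦconv X hX
    have hYi : Integrable (fun ω => max (X ω - m) 0) μ :=
      (hXi.sub (integrable_const m)).pos_part
    have hYm : Measurable (fun ω => max (X ω - m) 0) :=
      (hX.1.sub_const m).max measurable_const
    have h1 : ∫ ω, X ω ∂μ - m ≤ ∫ ω, |max (X ω - m) 0| ∂μ := by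
      have : ∫ ω, X ω ∂μ - m = ∫ ω, (X ω - m) ∂μ := by
        rw [integral_sub hXi (integrable_const m)]; simp
      rw [this]
      apply integral_mono (hXi.sub (integrable_const m)) hYi.abs
      intro ω
      exact (le_max_left _ _).trans (le_abs_self _)
    refine h1.trans ?_
    rw [mul_comm, ← div_le_iff₀ hc0]
    apply le_csInf (hg_nonempty μ Φ hΦ0 hΦmono hΦconv α hα X hX m)
    rintro l ⟨hl, hle⟩
    rw [div_le_iff₀ hc0, mul_comm]
    exact hg_bound μ Φ hΦ0 hΦmono α hα p hp hs _ hYm hYi l hl hle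

theorem lux_nonneg {Ω : Type*} [MeasurableSpace Ω] (μ : Measure Ω)
    (Θ : ℝ → ℝ) (X : Ω → ℝ) : 0 ≤ luxNorm μ Θ X :=
  Real.sInf_nonneg fun _ h => h.1.le

theorem lux_le {Ω : Type*} [MeasurableSpace Ω] (μ : Measure Ω)
    (Θ : ℝ → ℝ) (X : Ω → ℝ) (l : ℝ) (hl : 0 < l)
    (h : ∫⁻ ω, ENNReal.ofReal (Θ (|X ω| / l)) ∂μ ≤ 1) : luxNorm μ Θ X ≤ l :=
  csInf_le ⟨0, fun _ h => h.1.le⟩ ⟨hl, h⟩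

/-- Strengthened Fatou property: if `(X_n) ⊂ L^Φ` satisfies `inf_n E[X_n] > -∞` and
`X_n → X` a.s. with `X ∈ L^Φ`, then `π_α(X) ≤ liminf_n π_α(X_n)`. -/
theorem stmt_9 {Ω : Type*} [MeasurableSpace Ω] (μ : Measure Ω) [IsProbabilityMeasure μ]
    (hNA : ∀ A : Set Ω, MeasurableSet A → 0 < μ A →
      ∃ B : Set Ω, B ⊆ A ∧ MeasurableSet B ∧ 0 < μ B ∧ μ B < μ A)
    (Φ : ℝ → ℝ) (hΦ0 : Φ 0 = 0) (hΦ1 : Φ 1 = 1)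
    (hΦmono : MonotoneOn Φ (Ici 0)) (hΦconv : ConvexOn ℝ (Ici 0) Φ)
    (α : ℝ) (hα : α ∈ Ioo (0 : ℝ) 1)
    (Xn : ℕ → Ω → ℝ) (X : Ω → ℝ)
    (hXn : ∀ n, MemOrlicz μ Φ (Xn n)) (hX : MemOrlicz μ Φ X)
    (hbdd : ∃ b : ℝ, ∀ n, b ≤ ∫ ω, Xn n ω ∂μ)
    (hconv : ∀ᵐ ω ∂μ, Tendsto (fun n => Xn n ω) atTop (𝓝 (X ω))) :
    ((piHG μ Φ α X : ℝ) : EReal)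
      ≤ Filter.liminf (fun n => ((piHG μ Φ α (Xn n) : ℝ) : EReal)) atTop := by
  classical
  obtain ⟨b, hb⟩ := hbdd
  obtain ⟨c, hc0, hc1, hlow⟩ := hg_lower μ Φ hΦ0 hΦ1 hΦmono hΦconv α hα
  have hα' : 0 < 1 - α := by linarith [hα.2]
  by_contra hcon
  push Not at hcon
  obtain ⟨r, hr1, hr2⟩ := EReal.lt_iff_exists_real_btwn.1 hcon
  obtain ⟨r', hr3, hr4⟩ := EReal.lt_iff_exists_real_btwn.1 hr2
  have hrr : r < r' := EReal.coe_lt_coe_iff.1 hr3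
  have hr'p : r' < piHG μ Φ α X := EReal.coe_lt_coe_iff.1 hr4
  have hfreq : ∃ᶠ n in atTop, ((piHG μ Φ α (Xn n) : ℝ) : EReal) < (r : EReal) :=
    frequently_lt_of_liminf_lt (by isBoundedDefault) hr1
  obtain ⟨φ, hφ, hφlt⟩ := extraction_of_frequently_atTop hfreq
  have hm : ∀ k, ∃ m : ℝ, m + luxNorm μ (fun x => Φ x / (1 - α))
      (fun ω => max (Xn (φ k) ω - m) 0) < r := fun k =>
    exists_lt_of_ciInf_lt (EReal.coe_lt_coe_iff.1 (hφlt k))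
  choose m hm using hm
  have hmem : ∀ k, m k ∈ Icc ((b - c * r) / (1 - c)) r := by
    intro k
    have h1 := lux_nonneg μ (fun x => Φ x / (1 - α)) (fun ω => max (Xn (φ k) ω - m k) 0)
    have h2 := hlow _ (hXn (φ k)) (m k)
    have h3 := hb (φ k)
    have h4 := hm k
    refine ⟨?_, by linarith⟩
    rw [div_le_iff₀ (by linarith)]
    nlinarith
  obtain ⟨m0, hm0, ψ, hψ, hlim⟩ := isCompact_Icc.tendsto_subseq hmem
  have hl0 : 0 < r' - m0 := by linarith [hm0.2]
  have hlk : ∀ k, 0 < r' - m k := fun k => by linarith [(hmem k).2]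
  have hint : ∀ k, ∫⁻ ω, ENNReal.ofReal
      (Φ (|max (Xn (φ k) ω - m k) 0| / (r' - m k)) / (1 - α)) ∂μ ≤ 1 := by
    intro k
    have h1 : luxNorm μ (fun x => Φ x / (1 - α))
      (fun ω => max (Xn (φ k) ω - m k) 0) < r' - m k := by linarith [hm k]
    obtain ⟨l, ⟨hl, hle⟩, hlt⟩ := exists_lt_of_csInf_lt
      (hg_nonempty μ Φ hΦ0 hΦmono hΦconv α hα _ (hXn (φ k)) (m k)) h1
    refine le_trans (lintegral_mono fun ω => ?_) hle
    apply ENNReal.ofReal_le_ofReal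
    apply div_le_div_of_nonneg_right _ hα'.le
    have := hlk k
    apply hΦmono
    · simp only [mem_Ici]; positivity
    · simp only [mem_Ici]; positivity
    · exact div_le_div_of_nonneg_left (abs_nonneg _) hl hlt.le
  have hfat : ∫⁻ ω, ENNReal.ofReal
      (Φ (|max (X ω - m0) 0| / (r' - m0)) / (1 - α)) ∂μ ≤ 1 := by
    have hae : ∀ᵐ ω ∂μ, ENNReal.ofReal (Φ (|max (X ω - m0) 0| / (r' - m0)) / (1 - α))
        = liminf (fun k => ENNReal.ofReal
          (Φ (|max (Xn (φ (ψ k)) ω - m (ψ k)) 0| / (r' - m (ψ k))) / (1 - α))) atTop := by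
      filter_upwards [hconv] with ω hω
      symm
      apply Tendsto.liminf_eq
      have t1 : Tendsto (fun k => Xn (φ (ψ k)) ω) atTop (𝓝 (X ω)) :=
        hω.comp ((hφ.comp hψ).tendsto_atTop)
      have t2 : Tendsto (fun k => |max (Xn (φ (ψ k)) ω - m (ψ k)) 0| / (r' - m (ψ k))) atTop
          (𝓝 (|max (X ω - m0) 0| / (r' - m0))) :=
        (((t1.sub hlim).max tendsto_const_nhds).abs).div (tendsto_const_nhds.sub hlim) hl0.ne'
      have t3 := ((hg_cont Φ hΦ0 hΦ1 hΦmono hΦconv).tendsto _).comp t2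
      have t4 := (ENNReal.continuous_ofReal.tendsto _).comp (t3.div_const (1 - α))
      rw [max_eq_left (by positivity)] at t4
      refine t4.congr fun k => ?_
      have := hlk (ψ k)
      simp only [Function.comp]
      rw [max_eq_left (by positivity)]
    rw [lintegral_congr_ae hae]
    refine (lintegral_liminf_le fun k => ?_).trans ?_
    · exact ((hg_meas Φ hΦmono _ (((hXn _).1.sub_const _).max measurable_const) _
        (hlk (ψ k))).div_const _).ennreal_ofReal
    · exact (liminf_le_liminf (Eventually.of_forall fun k => hint (ψ k))).trans (by simp)
  have hbb : BddBelow (range fun m : ℝ => m + luxNorm μ (fun x => Φ x / (1 - α))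
      (fun ω => max (X ω - m) 0)) := by
    refine ⟨∫ ω, X ω ∂μ, ?_⟩
    rintro _ ⟨m, rfl⟩
    have h1 := lux_nonneg μ (fun x => Φ x / (1 - α)) (fun ω => max (X ω - m) 0)
    have h2 := hlow _ hX m
    simp only
    nlinarith
  have h1 : piHG μ Φ α X ≤ _ := ciInf_le hbb m0
  have h2 := lux_le μ (fun x => Φ x / (1 - α)) (fun ω => max (X ω - m0) 0) _ hl0 hfat
  linarith
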